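/- (Linear convergence of the two-node Gibbs sampler under strong convexity.) Let d ≥ 1, η > 0, let f : ℝ^d → ℝ be α_f-strongly convex and g : ℝ^d → ℝ be α_g-strongly convex (α_f, α_g > 0), and let π^{XY} be the probability measure on ℝ^d × ℝ^d with density proportional to exp(−f(x) − g(y) − ‖x−y‖²/(2η)), with marginals π^X, π^Y and conditionals π^{Y|X=x} ∝ exp(−g(y) − ‖x−y‖²/(2η)), π^{X|Y=y} ∝ exp(−f(x) − ‖x−y‖²/(2η)). Let μ_0^X be a probability measure on ℝ^d with D_KL(μ_0^X ‖ π^X) < ∞, and define recursively for k ≥ 0: μ_k^Y(y) = ∫ π^{Y|X=x}(y) dμ_k^X(x), μ_{k+1}^X(x) = ∫ π^{X|Y=y}(x) dμ_k^Y(y), and let μ_k^{XY} be the measure on ℝ^d × ℝ^d with density (x,y) ↦ μ_k^X(x) π^{Y|X=x}(y). Then for every k ≥ 0, D_KL(μ_k^{XY} ‖ π^{XY}) ≤ D_KL(μ_0^X ‖ π^X) / ((1 + η α_f)^{2k} (1 + η α_g)^{2k}). -/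

import Mathlib

open MeasureTheory Real
open scoped ENNReal Classical

noncomputable section

/-- Kullback–Leibler divergence `D_KL(μ ‖ ν) = ∫ log(dμ/dν) dμ` (valued in `[0,∞]`,
with the convention that it is `∞` when `μ` is not absolutely continuous w.r.t. `ν`;
for `μ ≪ ν` it is computed via the nonnegative integrand `f log f − f + 1`,
`f = dμ/dν`, integrated against `ν`). -/
def klDiv {X : Type*} [MeasurableSpace X] (μ ν : Measure X) : ℝ≥0∞ :=
  if μ ≪ ν then
    ∫⁻ x, ENNReal.ofReal ((μ.rnDeriv ν x).toReal * Real.log ((μ.rnDeriv ν x).toReal)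
      - (μ.rnDeriv ν x).toReal + 1) ∂ν
  else ⊤

variable (d : ℕ) (η : ℝ)

/-- Unnormalized density `exp(−f(x) − g(y) − ‖x−y‖²/(2η))` of the two-node target. -/
def jointDens (f g : EuclideanSpace ℝ (Fin d) → ℝ)
    (p : EuclideanSpace ℝ (Fin d) × EuclideanSpace ℝ (Fin d)) : ℝ :=
  Real.exp (-f p.1 - g p.2 - ‖p.1 - p.2‖ ^ 2 / (2 * η))

/-- The two-node target measure `π^{XY} ∝ exp(−f(x) − g(y) − ‖x−y‖²/(2η))`. -/
def targetXY (f g : EuclideanSpace ℝ (Fin d) → ℝ) :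
    Measure (EuclideanSpace ℝ (Fin d) × EuclideanSpace ℝ (Fin d)) :=
  volume.withDensity fun p =>
    ENNReal.ofReal (jointDens d η f g p / ∫ q, jointDens d η f g q)

/-- The `X`-marginal `π^X` of the two-node target. -/
def targetX (f g : EuclideanSpace ℝ (Fin d) → ℝ) :
    Measure (EuclideanSpace ℝ (Fin d)) :=
  (targetXY d η f g).map Prod.fst

/-- The conditional density `π^{Y|X=x}(y) ∝ exp(−g(y) − ‖x−y‖²/(2η))`. -/
def condYgivenX (g : EuclideanSpace ℝ (Fin d) → ℝ)
    (x y : EuclideanSpace ℝ (Fin d)) : ℝ :=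
  Real.exp (-g y - ‖x - y‖ ^ 2 / (2 * η)) /
    ∫ y', Real.exp (-g y' - ‖x - y'‖ ^ 2 / (2 * η))

/-- The conditional density `π^{X|Y=y}(x) ∝ exp(−f(x) − ‖x−y‖²/(2η))`. -/
def condXgivenY (f : EuclideanSpace ℝ (Fin d) → ℝ)
    (y x : EuclideanSpace ℝ (Fin d)) : ℝ :=
  Real.exp (-f x - ‖x - y‖ ^ 2 / (2 * η)) /
    ∫ x', Real.exp (-f x' - ‖x' - y‖ ^ 2 / (2 * η))

/-- The one-dimensional Brunn–Minkowski inequality. -/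
theorem volume_add_le_of_add_mem {S T U : Set ℝ} (hS : MeasurableSet S) (hT : MeasurableSet T)
    (hS0 : S.Nonempty) (hT0 : T.Nonempty) (h : ∀ s ∈ S, ∀ t ∈ T, s + t ∈ U) :
    volume S + volume T ≤ volume U := by
  have key : ∀ K L : Set ℝ, IsCompact K → IsCompact L → K.Nonempty → L.Nonempty → K ⊆ S → L ⊆ T →
      volume K + volume L ≤ volume U := by
    intro K L hK hL hK0 hL0 hKS hLT
    obtain ⟨a, haK, ha⟩ := hK.exists_isGreatest hK0
    obtain ⟨b, hbL, hb⟩ := hL.exists_isLeast hL0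
    have h1 : volume K ≤ volume (U ∩ Set.Iic (a + b)) := by
      rw [← measure_preimage_add_right volume b (U ∩ Set.Iic (a + b))]
      refine measure_mono fun x hx => ⟨h x (hKS hx) b (hLT hbL), ?_⟩
      exact add_le_add_left (ha hx) b
    have h2 : volume L ≤ volume (U ∩ Set.Ici (a + b)) := by
      rw [← measure_preimage_add volume a (U ∩ Set.Ici (a + b))]
      refine measure_mono fun x hx => ⟨h a (hKS haK) x (hLT hx), ?_⟩
      exact add_le_add_right (hb hx) a
    have h3 : volume (U ∩ Set.Ici (a + b)) = volume (U \ Set.Iic (a + b)) := by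
      rw [Set.sdiff_eq, Set.compl_Iic]
      exact measure_congr ((ae_eq_refl U).inter Ioi_ae_eq_Ici.symm)
    calc volume K + volume L ≤ volume (U ∩ Set.Iic (a + b)) + volume (U \ Set.Iic (a + b)) :=
          add_le_add h1 (h2.trans h3.le)
      _ = volume U := measure_inter_add_sdiff U measurableSet_Iic
  obtain ⟨s, hs⟩ := hS0
  obtain ⟨t, ht⟩ := hT0
  rw [hS.measure_eq_iSup_isCompact, hT.measure_eq_iSup_isCompact]
  simp only [iSup_and']
  refine ENNReal.biSup_add_biSup_le' ⟨∅, by simp⟩ ⟨∅, by simp⟩ ?_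
  rintro K ⟨hKS, hK⟩ L ⟨hLT, hL⟩
  refine le_trans (add_le_add (measure_mono (Set.subset_insert s K))
    (measure_mono (Set.subset_insert t L))) ?_
  exact key _ _ (hK.insert s) (hL.insert t) (Set.insert_nonempty _ _) (Set.insert_nonempty _ _)
    (Set.insert_subset hs hKS) (Set.insert_subset ht hLT)

/-- A Prékopa–Leindler inequality in arithmetic form, for functions with supremum one. -/
theorem arith_prekopa_leindler_of_le_one {a b m : ℝ → ℝ} {t : ℝ} (ht0 : 0 < t) (ht1 : t < 1)
    (ha : Measurable a) (hb : Measurable b) (hm : Measurable m)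
    (ha0 : ∀ x, 0 ≤ a x) (hb0 : ∀ x, 0 ≤ b x) (hm0 : ∀ x, 0 ≤ m x)
    (ha1 : ∀ x, a x ≤ 1) (hb1 : ∀ x, b x ≤ 1)
    (has : ∀ s < 1, ∃ x, s < a x) (hbs : ∀ s < 1, ∃ x, s < b x)
    (h : ∀ s, 0 < s → ∀ x y, s < a x → s < b y → s < m ((1 - t) * x + t * y)) :
    ENNReal.ofReal (1 - t) * (∫⁻ x, ENNReal.ofReal (a x)) +
        ENNReal.ofReal t * (∫⁻ x, ENNReal.ofReal (b x)) ≤ ∫⁻ x, ENNReal.ofReal (m x) := by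
  rw [lintegral_eq_lintegral_meas_lt volume (ae_of_all _ ha0) ha.aemeasurable,
    lintegral_eq_lintegral_meas_lt volume (ae_of_all _ hb0) hb.aemeasurable,
    lintegral_eq_lintegral_meas_lt volume (ae_of_all _ hm0) hm.aemeasurable,
    ← lintegral_const_mul' _ _ ENNReal.ofReal_ne_top,
    ← lintegral_const_mul' _ _ ENNReal.ofReal_ne_top, ← lintegral_add_left']
  swap
  · refine (Antitone.measurable ?_).aemeasurable
    intro s s' hs
    dsimp only
    gcongr
  refine setLIntegral_mono' measurableSet_Ioi fun s hs => ?_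
  rcases lt_or_ge s 1 with hs1 | hs1
  swap
  · have e1 : {x | s < a x} = ∅ := Set.eq_empty_of_forall_notMem fun x hx =>
      absurd (lt_of_lt_of_le hx (ha1 x)) (not_lt.2 hs1)
    have e2 : {x | s < b x} = ∅ := Set.eq_empty_of_forall_notMem fun x hx =>
      absurd (lt_of_lt_of_le hx (hb1 x)) (not_lt.2 hs1)
    simp [e1, e2]
  have ht1' : 0 < 1 - t := by linarith
  have scale : ∀ (c : ℝ), 0 < c → ∀ S : Set ℝ,
      ENNReal.ofReal c * volume S = volume ((fun x => c⁻¹ * x) ⁻¹' S) := by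
    intro c hc S
    rw [Real.volume_preimage_mul_left (inv_ne_zero hc.ne'), inv_inv, abs_of_pos hc]
  rw [scale _ ht1', scale _ ht0]
  refine volume_add_le_of_add_mem (measurableSet_preimage (by fun_prop) (measurableSet_lt measurable_const ha))
    (measurableSet_preimage (by fun_prop) (measurableSet_lt measurable_const hb)) ?_ ?_ ?_
  · obtain ⟨x, hx⟩ := has s hs1
    exact ⟨(1 - t) * x, by simpa [inv_mul_cancel_left₀ ht1'.ne'] using hx⟩
  · obtain ⟨x, hx⟩ := hbs s hs1
    exact ⟨t * x, by simpa [inv_mul_cancel_left₀ ht0.ne'] using hx⟩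
  · intro x hx y hy
    have := h s hs _ _ hx hy
    rwa [mul_inv_cancel_left₀ ht1'.ne', mul_inv_cancel_left₀ ht0.ne'] at this

theorem ENNReal.rpow_mul_rpow_le_add (p q : ℝ≥0∞) {t : ℝ} (ht0 : 0 < t) (ht1 : t < 1) :
    p ^ (1 - t) * q ^ t ≤ ENNReal.ofReal (1 - t) * p + ENNReal.ofReal t * q := by
  have ht1' : 0 < 1 - t := by linarith
  have hc : Real.HolderConjugate (1 - t)⁻¹ t⁻¹ := by
    refine Real.holderConjugate_iff.2 ⟨?_, by simp⟩
    exact (one_lt_inv₀ ht1').2 (by linarith)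
  have := ENNReal.young_inequality (p ^ (1 - t)) (q ^ t) hc
  rwa [← ENNReal.rpow_mul, ← ENNReal.rpow_mul, mul_inv_cancel₀ ht1'.ne', mul_inv_cancel₀ ht0.ne',
    ENNReal.rpow_one, ENNReal.rpow_one, ENNReal.ofReal_inv_of_pos ht1', ENNReal.ofReal_inv_of_pos ht0,
    ENNReal.div_eq_inv_mul, ENNReal.div_eq_inv_mul, inv_inv, inv_inv] at this

theorem prekopa_leindler_real_of_bounded {a b m : ℝ → ℝ≥0∞} {t : ℝ} (ht0 : 0 < t) (ht1 : t < 1)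
    (ha : Measurable a) (hb : Measurable b) (hm : Measurable m)
    (ha1 : ⨆ x, a x ≠ ∞) (hb1 : ⨆ x, b x ≠ ∞)
    (h : ∀ x y, a x ^ (1 - t) * b y ^ t ≤ m ((1 - t) * x + t * y)) :
    (∫⁻ x, a x) ^ (1 - t) * (∫⁻ x, b x) ^ t ≤ ∫⁻ x, m x := by
  have ht1' : 0 < 1 - t := by linarith
  set A := ⨆ x, a x with hA
  set B := ⨆ x, b x with hB
  rcases eq_or_ne A 0 with hA0 | hA0
  · have : ∀ x, a x = 0 := fun x => le_antisymm (hA0 ▸ le_iSup a x) bot_le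
    simp [this, ENNReal.zero_rpow_of_pos ht1']
  rcases eq_or_ne B 0 with hB0 | hB0
  · have : ∀ x, b x = 0 := fun x => le_antisymm (hB0 ▸ le_iSup b x) bot_le
    simp [this, ENNReal.zero_rpow_of_pos ht0]
  set D := A ^ (1 - t) * B ^ t with hD
  have hD0 : D ≠ 0 := mul_ne_zero (by simp [hA0, ha1]) (by simp [hB0, hb1])
  have hDt : D ≠ ∞ := ENNReal.mul_ne_top (ENNReal.rpow_ne_top_of_nonneg ht1'.le ha1)
    (ENNReal.rpow_ne_top_of_nonneg ht0.le hb1)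
  have hal : ∀ x, a x / A ≤ 1 := fun x =>
    ENNReal.div_le_of_le_mul (by rw [one_mul]; exact le_iSup a x)
  have hbl : ∀ x, b x / B ≤ 1 := fun x =>
    ENNReal.div_le_of_le_mul (by rw [one_mul]; exact le_iSup b x)
  have hml : ∀ x, min 1 (m x / D) ≠ ∞ := fun x => ne_top_of_le_ne_top ENNReal.one_ne_top (min_le_left _ _)
  have hat : ∀ x, a x / A ≠ ∞ := fun x => ne_top_of_le_ne_top ENNReal.one_ne_top (hal x)
  have hbt : ∀ x, b x / B ≠ ∞ := fun x => ne_top_of_le_ne_top ENNReal.one_ne_top (hbl x)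
  have hsup : ∀ (u : ℝ → ℝ≥0∞) (U : ℝ≥0∞), U = ⨆ x, u x → U ≠ 0 → U ≠ ∞ →
      (∀ x, u x / U ≠ ∞) → ∀ s < 1, ∃ x, s < (u x / U).toReal := by
    intro u U hU hU0 hUt hut s hs
    have h1 : ENNReal.ofReal s < 1 := by simpa using hs
    have h2 : ENNReal.ofReal s * U < ⨆ x, u x := by
      rw [← hU]
      conv_rhs => rw [← one_mul U]
      exact ENNReal.mul_lt_mul_left hU0 hUt h1
    obtain ⟨x, hx⟩ := lt_iSup_iff.1 h2
    refine ⟨x, ?_⟩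
    have : ENNReal.ofReal s < u x / U := by
      rwa [ENNReal.lt_div_iff_mul_lt (Or.inl hU0) (Or.inl hUt)]
    rcases lt_or_ge s 0 with h0 | h0
    · exact h0.trans_le ENNReal.toReal_nonneg
    · exact (ENNReal.ofReal_lt_iff_lt_toReal h0 (hut x)).1 this
  have key := arith_prekopa_leindler_of_le_one (a := fun x => (a x / A).toReal)
    (b := fun x => (b x / B).toReal) (m := fun x => (min 1 (m x / D)).toReal) ht0 ht1
    (by fun_prop) (by fun_prop) (by fun_prop) (fun _ => ENNReal.toReal_nonneg)
    (fun _ => ENNReal.toReal_nonneg) (fun _ => ENNReal.toReal_nonneg)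
    (fun x => ENNReal.toReal_le_of_le_ofReal zero_le_one (by simpa using hal x))
    (fun x => ENNReal.toReal_le_of_le_ofReal zero_le_one (by simpa using hbl x))
    (hsup a A rfl hA0 ha1 hat) (hsup b B rfl hB0 hb1 hbt) ?_
  · simp only [ENNReal.ofReal_toReal, hat, hbt, hml, ne_eq, not_false_eq_true] at key
    have k2 := (ENNReal.rpow_mul_rpow_le_add (∫⁻ x, a x / A) (∫⁻ x, b x / B) ht0 ht1).trans key
    have k3 : ∫⁻ x, min 1 (m x / D) ≤ (∫⁻ x, m x) / D := by
      refine (lintegral_mono fun x => min_le_right _ _).trans ?_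
      simp only [ENNReal.div_eq_inv_mul]
      rw [lintegral_const_mul' _ _ (ENNReal.inv_ne_top.2 hD0)]
    have k4 := k2.trans k3
    have ea : ∫⁻ x, a x = A * ∫⁻ x, a x / A := by
      rw [← lintegral_const_mul' _ _ ha1]
      simp_rw [ENNReal.mul_div_cancel hA0 ha1]
    have eb : ∫⁻ x, b x = B * ∫⁻ x, b x / B := by
      rw [← lintegral_const_mul' _ _ hb1]
      simp_rw [ENNReal.mul_div_cancel hB0 hb1]
    rw [ea, eb, ENNReal.mul_rpow_of_nonneg _ _ ht1'.le, ENNReal.mul_rpow_of_nonneg _ _ ht0.le,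
      mul_mul_mul_comm, mul_comm]
    rwa [ENNReal.le_div_iff_mul_le (Or.inl hD0) (Or.inl hDt)] at k4
  · intro s hs x y hx hy
    have hs' : (0 : ℝ≥0∞) < ENNReal.ofReal s := by simpa using hs
    have hx' := (ENNReal.ofReal_lt_iff_lt_toReal hs.le (hat x)).2 hx
    have hy' := (ENNReal.ofReal_lt_iff_lt_toReal hs.le (hbt y)).2 hy
    refine (ENNReal.ofReal_lt_iff_lt_toReal hs.le (hml _)).1 (lt_min (hx'.trans_le (hal x)) ?_)
    have h1 : ENNReal.ofReal s = ENNReal.ofReal s ^ (1 - t) * ENNReal.ofReal s ^ t := by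
      rw [← ENNReal.rpow_add _ _ hs'.ne' ENNReal.ofReal_ne_top]; simp
    rw [h1]
    calc _ < (a x / A) ^ (1 - t) * (b y / B) ^ t :=
          ENNReal.mul_lt_mul (ENNReal.rpow_lt_rpow hx' ht1') (ENNReal.rpow_lt_rpow hy' ht0)
      _ = (a x ^ (1 - t) * b y ^ t) / D := by
          rw [ENNReal.div_rpow_of_nonneg _ _ ht1'.le, ENNReal.div_rpow_of_nonneg _ _ ht0.le, hD,
            ENNReal.mul_div_mul_comm]
          · left; simp [hA0, ha1]
          · left; exact ENNReal.rpow_ne_top_of_nonneg ht1'.le ha1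
      _ ≤ _ := ENNReal.div_le_div_right (h x y) D

theorem prekopa_leindler_real {a b m : ℝ → ℝ≥0∞} {t : ℝ} (ht0 : 0 < t) (ht1 : t < 1)
    (ha : Measurable a) (hb : Measurable b) (hm : Measurable m)
    (h : ∀ x y, a x ^ (1 - t) * b y ^ t ≤ m ((1 - t) * x + t * y)) :
    (∫⁻ x, a x) ^ (1 - t) * (∫⁻ x, b x) ^ t ≤ ∫⁻ x, m x := by
  have ht1' : 0 < 1 - t := by linarith
  have trunc : ∀ u : ℝ → ℝ≥0∞, Measurable u →
      Filter.Tendsto (fun n : ℕ => ∫⁻ x, min (n : ℝ≥0∞) (u x)) Filter.atTop (nhds (∫⁻ x, u x)) := by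
    intro u hu
    refine lintegral_tendsto_of_tendsto_of_monotone (fun n => by fun_prop) (ae_of_all _ ?_) (ae_of_all _ ?_)
    · intro x i j hij
      exact min_le_min_right _ (by exact_mod_cast hij)
    · intro x
      have := (ENNReal.tendsto_nat_nhds_top).min (tendsto_const_nhds (x := u x))
      simpa using this
  have main : ∀ n : ℕ, (∫⁻ x, min (n : ℝ≥0∞) (a x)) ^ (1 - t) * (∫⁻ x, min (n : ℝ≥0∞) (b x)) ^ t
      ≤ ∫⁻ x, m x := by
    intro n
    refine prekopa_leindler_real_of_bounded ht0 ht1 (by fun_prop) (by fun_prop) hm ?_ ?_ fun x y => ?_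
    · exact ne_top_of_le_ne_top (ENNReal.natCast_ne_top n) (iSup_le fun x => min_le_left _ _)
    · exact ne_top_of_le_ne_top (ENNReal.natCast_ne_top n) (iSup_le fun x => min_le_left _ _)
    · refine le_trans ?_ (h x y)
      gcongr <;> exact min_le_right _ _
  rcases eq_or_ne (∫⁻ x, a x) 0 with h0 | h0
  · simp [h0, ENNReal.zero_rpow_of_pos ht1']
  rcases eq_or_ne (∫⁻ x, b x) 0 with h0' | h0'
  · simp [h0', ENNReal.zero_rpow_of_pos ht0]
  refine le_of_tendsto' (ENNReal.Tendsto.mul ((trunc a ha).ennrpow_const _) (Or.inl ?_)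
    ((trunc b hb).ennrpow_const _) (Or.inl ?_)) main
  · simp [h0, ht1'.not_gt]
  · simp [h0', ht0.not_gt]

theorem prekopa_leindler_pi {t : ℝ} (ht0 : 0 < t) (ht1 : t < 1) : ∀ (n : ℕ)
    {a b m : (Fin n → ℝ) → ℝ≥0∞} (_ : Measurable a) (_ : Measurable b) (_ : Measurable m)
    (_ : ∀ x y, a x ^ (1 - t) * b y ^ t ≤ m ((1 - t) • x + t • y)),
    (∫⁻ x, a x) ^ (1 - t) * (∫⁻ x, b x) ^ t ≤ ∫⁻ x, m x
  | 0, a, b, m, _, _, _, h => by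
    simp only [Measure.volume_pi_eq_dirac (0 : Fin 0 → ℝ)]
    rw [lintegral_dirac, lintegral_dirac, lintegral_dirac]
    exact (h _ _).trans_eq (congrArg m (Subsingleton.elim _ _))
  | n + 1, a, b, m, ha, hb, hm, h => by
    have split : ∀ u : (Fin (n + 1) → ℝ) → ℝ≥0∞, Measurable u →
        ∫⁻ x, u x = ∫⁻ r : ℝ, ∫⁻ y : Fin n → ℝ,
          u ((MeasurableEquiv.piFinSuccAbove (fun _ => ℝ) 0).symm (r, y)) := by
      intro u hu
      rw [← ((volume_preserving_piFinSuccAbove (fun _ : Fin (n + 1) => ℝ) 0).symm).lintegral_comp hu,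
        Measure.volume_eq_prod, lintegral_prod]
      exact (hu.comp (MeasurableEquiv.measurable _)).aemeasurable
    have meas : ∀ u : (Fin (n + 1) → ℝ) → ℝ≥0∞, Measurable u → Measurable fun p : ℝ × (Fin n → ℝ) =>
        u ((MeasurableEquiv.piFinSuccAbove (fun _ => ℝ) 0).symm p) :=
      fun u hu => hu.comp (MeasurableEquiv.measurable _)
    rw [split a ha, split b hb, split m hm]
    refine prekopa_leindler_real ht0 ht1 (meas a ha).lintegral_prod_right'
      (meas b hb).lintegral_prod_right' (meas m hm).lintegral_prod_right' fun r s => ?_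
    refine prekopa_leindler_pi ht0 ht1 n ((meas a ha).comp measurable_prodMk_left)
      ((meas b hb).comp measurable_prodMk_left) ((meas m hm).comp measurable_prodMk_left) fun x y => ?_
    refine (h _ _).trans_eq (congrArg m ?_)
    ext i
    refine Fin.cases ?_ (fun j => ?_) i <;> simp [MeasurableEquiv.piFinSuccAbove]

/-- The **Prékopa–Leindler inequality** on Euclidean space. -/
theorem prekopa_leindler {n : ℕ} {t : ℝ} (ht0 : 0 < t) (ht1 : t < 1)
    {a b m : EuclideanSpace ℝ (Fin n) → ℝ≥0∞} (ha : Measurable a) (hb : Measurable b)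
    (hm : Measurable m) (h : ∀ x y, a x ^ (1 - t) * b y ^ t ≤ m ((1 - t) • x + t • y)) :
    (∫⁻ x, a x) ^ (1 - t) * (∫⁻ x, b x) ^ t ≤ ∫⁻ x, m x := by
  have hp := PiLp.volume_preserving_toLp (Fin n)
  rw [← hp.lintegral_comp ha, ← hp.lintegral_comp hb, ← hp.lintegral_comp hm]
  exact prekopa_leindler_pi ht0 ht1 n (ha.comp hp.measurable) (hb.comp hp.measurable)
    (hm.comp hp.measurable) fun x y => (h _ _)

theorem StrongConvexOn.continuous_of_univ {d : ℕ} {g : EuclideanSpace ℝ (Fin d) → ℝ} {α : ℝ}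
    (hα : 0 < α) (hg : StrongConvexOn Set.univ α g) : Continuous g := by
  have : ConvexOn ℝ Set.univ g := (hg.strictConvexOn hα).convexOn
  exact this.locallyLipschitz.continuous

theorem StrongConvexOn.exists_quadratic_lower_bound {d : ℕ} {g : EuclideanSpace ℝ (Fin d) → ℝ}
    {α : ℝ} (hα : 0 < α) (hg : StrongConvexOn Set.univ α g) :
    ∃ C : ℝ, ∀ x, α / 4 * ‖x‖ ^ 2 - C ≤ g x := by
  obtain ⟨M, hM⟩ := (isCompact_closedBall (0 : EuclideanSpace ℝ (Fin d)) 1).exists_bound_of_continuousOn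
    (hg.continuous_of_univ hα).continuousOn
  have hM' : ∀ x : EuclideanSpace ℝ (Fin d), ‖x‖ ≤ 1 → |g x| ≤ M := fun x hx => by
    simpa using hM x (by simpa using hx)
  have hM0 : 0 ≤ M := (abs_nonneg _).trans (hM' 0 (by simp))
  have h0 := abs_le.1 (hM' 0 (by simp))
  refine ⟨(2 * M + α / 2) ^ 2 / α + M + α / 4, fun x => ?_⟩
  have hq : 0 ≤ (2 * M + α / 2) ^ 2 / α := by positivity
  rcases le_or_gt ‖x‖ 1 with hx | hx
  · have h1 := abs_le.1 (hM' x hx)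
    have h2 : ‖x‖ ^ 2 ≤ 1 := by nlinarith [norm_nonneg x]
    nlinarith
  · set r := ‖x‖ with hr
    have hr0 : 0 < r := by linarith
    have hu := abs_le.1 (hM' (r⁻¹ • x) (by
      rw [norm_smul, ← hr, Real.norm_of_nonneg (by positivity), inv_mul_cancel₀ hr0.ne']))
    have hinv : r⁻¹ ≤ 1 := inv_le_one_of_one_le₀ hx.le
    have hc := hg.2 (Set.mem_univ x) (Set.mem_univ 0)
      (show (0 : ℝ) ≤ r⁻¹ by positivity) (show (0 : ℝ) ≤ 1 - r⁻¹ by linarith) (by ring)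
    simp only [smul_zero, add_zero, sub_zero, smul_eq_mul, ← hr] at hc
    have hc2 : r * g (r⁻¹ • x) ≤ g x + (r - 1) * g 0 - (r - 1) * (α / 2 * r) := by
      have := mul_le_mul_of_nonneg_left hc hr0.le
      refine this.trans_eq ?_
      field_simp
    have hsq : 0 ≤ α / 4 * r ^ 2 - (2 * M + α / 2) * r + (2 * M + α / 2) ^ 2 / α := by
      have : α / 4 * r ^ 2 - (2 * M + α / 2) * r + (2 * M + α / 2) ^ 2 / α
          = (α / 2 * r - (2 * M + α / 2)) ^ 2 / α := by
        field_simp; ring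
      rw [this]; positivity
    nlinarith [mul_le_mul_of_nonneg_left hu.1 hr0.le,
      mul_le_mul_of_nonneg_left h0.2 (by linarith : (0:ℝ) ≤ r - 1)]

theorem StrongConvexOn.integrable_exp_neg {d : ℕ} {g : EuclideanSpace ℝ (Fin d) → ℝ} {α : ℝ}
    (hα : 0 < α) (hg : StrongConvexOn Set.univ α g) : Integrable fun y => rexp (-g y) := by
  obtain ⟨C, hC⟩ := hg.exists_quadratic_lower_bound hα
  have h1 : Integrable fun y : EuclideanSpace ℝ (Fin d) => rexp (-(α / 4) * ‖y‖ ^ 2) := by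
    have := (GaussianFourier.integrable_cexp_neg_mul_sq_norm_add (b := ((α / 4 : ℝ) : ℂ))
      (by simpa using hα) 0 (0 : EuclideanSpace ℝ (Fin d))).norm
    refine this.congr (ae_of_all _ fun y => ?_)
    simp only [Complex.norm_exp, zero_mul, add_zero]
    congr 1
    norm_cast
  refine (h1.const_mul (rexp C)).mono'
    (Real.continuous_exp.comp (hg.continuous_of_univ hα).neg).aestronglyMeasurable
    (ae_of_all _ fun y => ?_)
  rw [Real.norm_of_nonneg (Real.exp_nonneg _), ← Real.exp_add, Real.exp_le_exp]
  linarith [hC y]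

section Gibbs

variable {d : ℕ} {η : ℝ} {g : EuclideanSpace ℝ (Fin d) → ℝ} {α : ℝ}

/-- The integral of `exp (h y - g y - ‖x - y‖ ^ 2 / (2 η))` over `y`. -/
def tiltedMass (d : ℕ) (η : ℝ) (g h : EuclideanSpace ℝ (Fin d) → ℝ)
    (x : EuclideanSpace ℝ (Fin d)) : ℝ :=
  ∫ y, rexp (h y - g y - ‖x - y‖ ^ 2 / (2 * η))

theorem integrable_tiltedMass (hη : 0 < η) (hα : 0 < α) (hg : StrongConvexOn Set.univ α g)
    {h : EuclideanSpace ℝ (Fin d) → ℝ} (hh : Measurable h) {H : ℝ} (hH : ∀ y, h y ≤ H)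
    (x : EuclideanSpace ℝ (Fin d)) :
    Integrable fun y => rexp (h y - g y - ‖x - y‖ ^ 2 / (2 * η)) := by
  have hgm := (hg.continuous_of_univ hα).measurable
  refine ((hg.integrable_exp_neg hα).const_mul (rexp H)).mono'
    (by fun_prop) (ae_of_all _ fun y => ?_)
  rw [Real.norm_of_nonneg (Real.exp_nonneg _), ← Real.exp_add, Real.exp_le_exp]
  have : 0 ≤ ‖x - y‖ ^ 2 / (2 * η) := by positivity
  linarith [hH y]

theorem tiltedMass_pos (hη : 0 < η) (hα : 0 < α) (hg : StrongConvexOn Set.univ α g)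
    {h : EuclideanSpace ℝ (Fin d) → ℝ} (hh : Measurable h) {H : ℝ} (hH : ∀ y, h y ≤ H)
    (x : EuclideanSpace ℝ (Fin d)) : 0 < tiltedMass d η g h x :=
  integral_exp_pos (integrable_tiltedMass hη hα hg hh hH x)

theorem measurable_tiltedMass (hgm : Measurable g) {h : EuclideanSpace ℝ (Fin d) → ℝ}
    (hh : Measurable h) : Measurable (tiltedMass d η g h) := by
  have : StronglyMeasurable fun p : EuclideanSpace ℝ (Fin d) × EuclideanSpace ℝ (Fin d) =>
      rexp (h p.2 - g p.2 - ‖p.1 - p.2‖ ^ 2 / (2 * η)) :=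
    Measurable.stronglyMeasurable (by fun_prop)
  exact this.integral_prod_right.measurable

theorem condYgivenX_eq (g : EuclideanSpace ℝ (Fin d) → ℝ) (x y : EuclideanSpace ℝ (Fin d)) :
    condYgivenX d η g x y =
      rexp (-g y - ‖x - y‖ ^ 2 / (2 * η)) / tiltedMass d η g 0 x := by
  simp [condYgivenX, tiltedMass]

theorem condXgivenY_eq (f : EuclideanSpace ℝ (Fin d) → ℝ) :
    condXgivenY d η f = condYgivenX d η f := by
  funext y x
  simp [condXgivenY, condYgivenX, norm_sub_rev]

theorem measurable_condYgivenX (hgm : Measurable g) :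
    Measurable (Function.uncurry (condYgivenX d η g)) := by
  have hZ := measurable_tiltedMass (η := η) hgm (h := 0) measurable_zero
  have : Function.uncurry (condYgivenX d η g) = fun p =>
      rexp (-g p.2 - ‖p.1 - p.2‖ ^ 2 / (2 * η)) / tiltedMass d η g 0 p.1 := by
    funext p; exact condYgivenX_eq g p.1 p.2
  rw [this]
  fun_prop

theorem condYgivenX_nonneg (g : EuclideanSpace ℝ (Fin d) → ℝ) (x y : EuclideanSpace ℝ (Fin d)) :
    0 ≤ condYgivenX d η g x y :=
  div_nonneg (Real.exp_nonneg _) (integral_nonneg fun _ => Real.exp_nonneg _)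

/-- The Markov kernel with density `condYgivenX`. -/
def gibbsKernel (d : ℕ) (η : ℝ) (g : EuclideanSpace ℝ (Fin d) → ℝ) :
    ProbabilityTheory.Kernel (EuclideanSpace ℝ (Fin d)) (EuclideanSpace ℝ (Fin d)) :=
  ProbabilityTheory.Kernel.withDensity (ProbabilityTheory.Kernel.const _ volume)
    fun x y => ENNReal.ofReal (condYgivenX d η g x y)

theorem gibbsKernel_apply (hgm : Measurable g) (x : EuclideanSpace ℝ (Fin d)) :
    gibbsKernel d η g x = volume.withDensity fun y => ENNReal.ofReal (condYgivenX d η g x y) := by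
  rw [gibbsKernel, ProbabilityTheory.Kernel.withDensity_apply _
    (measurable_condYgivenX hgm).ennreal_ofReal]
  rfl

theorem integrable_gibbsKernel_iff (hgm : Measurable g) (x : EuclideanSpace ℝ (Fin d))
    (φ : EuclideanSpace ℝ (Fin d) → ℝ) :
    Integrable φ (gibbsKernel d η g x) ↔ Integrable fun y => condYgivenX d η g x y * φ y := by
  have hm : Measurable (condYgivenX d η g x) :=
    (measurable_condYgivenX (η := η) hgm).comp measurable_prodMk_left
  rw [gibbsKernel_apply hgm, integrable_withDensity_iff_integrable_smul' hm.ennreal_ofReal (by simp)]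
  simp [ENNReal.toReal_ofReal (condYgivenX_nonneg g x _)]

theorem integral_gibbsKernel (hgm : Measurable g) (x : EuclideanSpace ℝ (Fin d))
    (φ : EuclideanSpace ℝ (Fin d) → ℝ) :
    ∫ y, φ y ∂(gibbsKernel d η g x) = ∫ y, condYgivenX d η g x y * φ y := by
  have hm : Measurable (condYgivenX d η g x) :=
    (measurable_condYgivenX (η := η) hgm).comp measurable_prodMk_left
  rw [gibbsKernel_apply hgm, integral_withDensity_eq_integral_toReal_smul hm.ennreal_ofReal (by simp)]
  simp [ENNReal.toReal_ofReal (condYgivenX_nonneg g x _)]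

theorem isMarkovKernel_gibbsKernel (hη : 0 < η) (hα : 0 < α) (hg : StrongConvexOn Set.univ α g) :
    ProbabilityTheory.IsMarkovKernel (gibbsKernel d η g) := by
  refine ⟨fun x => ⟨?_⟩⟩
  have hZ := tiltedMass_pos hη hα hg (h := 0) measurable_zero (H := 0) (fun _ => le_rfl) x
  have hi := integrable_tiltedMass hη hα hg (h := 0) measurable_zero (H := 0) (fun _ => le_rfl) x
  simp only [Pi.zero_apply, zero_sub] at hi
  rw [gibbsKernel_apply (hg.continuous_of_univ hα).measurable, withDensity_apply _ MeasurableSet.univ,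
    Measure.restrict_univ]
  simp only [condYgivenX_eq]
  rw [← ofReal_integral_eq_lintegral_ofReal (hi.div_const _)
    (ae_of_all _ fun y => div_nonneg (Real.exp_nonneg _) hZ.le), integral_div]
  have : ∫ y, rexp (-g y - ‖x - y‖ ^ 2 / (2 * η)) = tiltedMass d η g 0 x := by simp [tiltedMass]
  rw [this, div_self hZ.ne', ENNReal.ofReal_one]

/-- The mean displacement of the kernel in direction `v`. -/
def drift (d : ℕ) (η : ℝ) (g : EuclideanSpace ℝ (Fin d) → ℝ) (x v : EuclideanSpace ℝ (Fin d)) : ℝ :=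
  ∫ y, inner ℝ v (x - y) ∂(gibbsKernel d η g x)

theorem drift_smul (x v : EuclideanSpace ℝ (Fin d)) (c : ℝ) :
    drift d η g x (c • v) = c * drift d η g x v := by
  simp only [drift, inner_smul_left, conj_trivial]
  exact integral_const_mul _ _

theorem condYgivenX_mul_exp (hη : 0 < η) (h : EuclideanSpace ℝ (Fin d) → ℝ)
    (x v y : EuclideanSpace ℝ (Fin d)) :
    condYgivenX d η g x y * rexp (h y - (2 * inner ℝ v (x - y) + ‖v‖ ^ 2) / (2 * η)) =
      rexp (h y - g y - ‖x + v - y‖ ^ 2 / (2 * η)) / tiltedMass d η g 0 x := by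
  rw [condYgivenX_eq, div_mul_eq_mul_div, ← Real.exp_add]
  congr 2
  have : x + v - y = (x - y) + v := by abel
  rw [this, norm_add_sq_real, real_inner_comm]
  field_simp
  ring

theorem integrable_inner_gibbsKernel (hη : 0 < η) (hα : 0 < α) (hg : StrongConvexOn Set.univ α g)
    (x v : EuclideanSpace ℝ (Fin d)) :
    Integrable (fun y => inner ℝ v (x - y)) (gibbsKernel d η g x) := by
  have hgm := (hg.continuous_of_univ hα).measurable
  have hexp : ∀ w : EuclideanSpace ℝ (Fin d),
      Integrable (fun y => rexp (-(2 * inner ℝ w (x - y) + ‖w‖ ^ 2) / (2 * η)))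
        (gibbsKernel d η g x) := by
    intro w
    rw [integrable_gibbsKernel_iff hgm]
    refine ((integrable_tiltedMass hη hα hg (h := 0) measurable_zero (H := 0) (fun _ => le_rfl)
      (x + w)).div_const (tiltedMass d η g 0 x)).congr (ae_of_all _ fun y => ?_)
    simp only
    rw [← condYgivenX_mul_exp hη]
    simp only [Pi.zero_apply, zero_sub, neg_div]
  have hdom := (((hexp v).add (hexp (-v))).const_mul (rexp (‖v‖ ^ 2 / (2 * η)))).const_mul η
  refine hdom.mono' (by fun_prop) (ae_of_all _ fun y => ?_)
  simp only [Pi.add_apply, mul_add (rexp _), ← Real.exp_add, norm_neg, inner_neg_left]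
  set u : ℝ := inner ℝ v (x - y)
  have e1 : ‖v‖ ^ 2 / (2 * η) + -(2 * u + ‖v‖ ^ 2) / (2 * η) = -(u / η) := by field_simp; ring
  have e2 : ‖v‖ ^ 2 / (2 * η) + -(2 * -u + ‖v‖ ^ 2) / (2 * η) = u / η := by field_simp; ring
  rw [e1, e2]
  have hu : u = η * (u / η) := by field_simp
  have h1 := Real.add_one_le_exp (u / η)
  have h2 := Real.add_one_le_exp (-(u / η))
  have h3 := Real.exp_pos (u / η)
  have h4 := Real.exp_pos (-(u / η))
  conv_lhs => rw [hu]
  rw [norm_mul, Real.norm_of_nonneg hη.le, Real.norm_eq_abs]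
  refine mul_le_mul_of_nonneg_left (abs_le.2 ⟨by linarith, by linarith⟩) hη.le

/-- The Jensen inequality for the shifted partition function. -/
theorem log_tiltedMass_add_ge (hη : 0 < η) (hα : 0 < α) (hg : StrongConvexOn Set.univ α g)
    {h : EuclideanSpace ℝ (Fin d) → ℝ} (hh : Measurable h) {H : ℝ} (hH : ∀ y, |h y| ≤ H)
    (x v : EuclideanSpace ℝ (Fin d)) :
    log (tiltedMass d η g 0 x) + ∫ y, h y ∂(gibbsKernel d η g x)
      - (2 * drift d η g x v + ‖v‖ ^ 2) / (2 * η) ≤ log (tiltedMass d η g h (x + v)) := by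
  have hgm := (hg.continuous_of_univ hα).measurable
  have := isMarkovKernel_gibbsKernel hη hα hg
  have hH' : ∀ y, h y ≤ H := fun y => (le_abs_self _).trans (hH y)
  have hZ := tiltedMass_pos hη hα hg (h := 0) measurable_zero (H := 0) (fun _ => le_rfl) x
  have hW := tiltedMass_pos hη hα hg hh hH' (x + v)
  have hi := integrable_inner_gibbsKernel hη hα hg x v
  have hhi : Integrable h (gibbsKernel d η g x) :=
    (integrable_const H).mono' hh.aestronglyMeasurable (ae_of_all _ hH)
  have hlin : Integrable (fun y => (2 * inner ℝ v (x - y) + ‖v‖ ^ 2) / (2 * η))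
      (gibbsKernel d η g x) := ((hi.const_mul 2).add (integrable_const _)).div_const _
  have hexp : Integrable (fun y => rexp (h y - (2 * inner ℝ v (x - y) + ‖v‖ ^ 2) / (2 * η)))
      (gibbsKernel d η g x) := by
    rw [integrable_gibbsKernel_iff hgm]
    simp only [condYgivenX_mul_exp hη]
    exact (integrable_tiltedMass hη hα hg hh hH' (x + v)).div_const _
  have jensen := convexOn_exp.map_integral_le (μ := gibbsKernel d η g x)
    Real.continuous_exp.continuousOn isClosed_univ (ae_of_all _ fun _ => Set.mem_univ _)
    (hhi.sub hlin) hexp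
  simp only [Pi.sub_apply] at jensen
  rw [integral_sub hhi hlin, integral_div, integral_add (hi.const_mul 2) (integrable_const _),
    integral_const_mul, integral_gibbsKernel hgm x (fun y => rexp _)] at jensen
  simp only [condYgivenX_mul_exp hη, integral_const, probReal_univ, one_smul] at jensen
  rw [integral_div] at jensen
  change _ ≤ tiltedMass d η g h (x + v) / tiltedMass d η g 0 x at jensen
  have h2 := (Real.le_log_iff_exp_le (div_pos hW hZ)).2 jensen
  rw [Real.log_div hW.ne' hZ.ne'] at h2
  rw [drift]
  linarith

/-- The **Prékopa–Leindler inequality** in logarithmic form. -/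
theorem log_prekopa_leindler {t : ℝ} (ht0 : 0 < t) (ht1 : t < 1)
    {A B M : EuclideanSpace ℝ (Fin d) → ℝ} (hA : Measurable A) (hB : Measurable B)
    (hM : Measurable M) (iA : Integrable fun x => rexp (A x)) (iB : Integrable fun x => rexp (B x))
    (iM : Integrable fun x => rexp (M x))
    (h : ∀ x y, (1 - t) * A x + t * B y ≤ M ((1 - t) • x + t • y)) :
    (1 - t) * log (∫ x, rexp (A x)) + t * log (∫ x, rexp (B x)) ≤ log (∫ x, rexp (M x)) := by
  have ht1' : 0 < 1 - t := by linarith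
  have comb : ∀ p q : ℝ, ENNReal.ofReal (rexp p) ^ (1 - t) * ENNReal.ofReal (rexp q) ^ t =
      ENNReal.ofReal (rexp ((1 - t) * p + t * q)) := by
    intro p q
    rw [ENNReal.ofReal_rpow_of_pos (Real.exp_pos _), ENNReal.ofReal_rpow_of_pos (Real.exp_pos _),
      ← ENNReal.ofReal_mul (by positivity), ← Real.exp_mul, ← Real.exp_mul, ← Real.exp_add]
    ring_nf
  have key := prekopa_leindler ht0 ht1 hA.exp.ennreal_ofReal hB.exp.ennreal_ofReal
    hM.exp.ennreal_ofReal fun x y => by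
      rw [comb]
      exact ENNReal.ofReal_le_ofReal (Real.exp_le_exp.2 (h x y))
  have conv : ∀ F : EuclideanSpace ℝ (Fin d) → ℝ, Integrable (fun x => rexp (F x)) →
      ∫⁻ x, ENNReal.ofReal (rexp (F x)) = ENNReal.ofReal (rexp (log (∫ x, rexp (F x)))) := by
    intro F hF
    rw [Real.exp_log (integral_exp_pos hF), ofReal_integral_eq_lintegral_ofReal hF
      (ae_of_all _ fun _ => Real.exp_nonneg _)]
  rw [conv A iA, conv B iB, conv M iM, comb,
    ENNReal.ofReal_le_ofReal_iff (Real.exp_nonneg _), Real.exp_le_exp] at key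
  exact key

theorem norm_sq_convex_comb (s : ℝ) (u w : EuclideanSpace ℝ (Fin d)) :
    ‖(1 - s) • u + s • w‖ ^ 2 = (1 - s) * ‖u‖ ^ 2 + s * ‖w‖ ^ 2 - s * (1 - s) * ‖u - w‖ ^ 2 := by
  rw [norm_add_sq_real, norm_sub_sq_real, norm_smul, norm_smul, inner_smul_left, inner_smul_right,
    mul_pow, mul_pow]
  simp only [Real.norm_eq_abs, sq_abs, conj_trivial]
  ring

theorem norm_add_sq_le_of_pos (hη : 0 < η) (hα : 0 < α) (p q : EuclideanSpace ℝ (Fin d)) :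
    α / (1 + η * α) * ‖p + q‖ ^ 2 ≤ α * ‖p‖ ^ 2 + ‖q‖ ^ 2 / η := by
  have h1 : ‖p + q‖ ^ 2 ≤ (‖p‖ + ‖q‖) ^ 2 := by gcongr; exact norm_add_le _ _
  refine (mul_le_mul_of_nonneg_left h1 (by positivity)).trans ?_
  have : α * ‖p‖ ^ 2 + ‖q‖ ^ 2 / η - α / (1 + η * α) * (‖p‖ + ‖q‖) ^ 2 =
      (η * α * ‖p‖ - ‖q‖) ^ 2 / (η * (1 + η * α)) := by
    field_simp
    ring
  have h2 : 0 ≤ (η * α * ‖p‖ - ‖q‖) ^ 2 / (η * (1 + η * α)) := by positivity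
  linarith

/-- The partition function of the conditional law is strongly log-concave. -/
theorem log_tiltedMass_strongly_concave (hη : 0 < η) (hα : 0 < α)
    (hg : StrongConvexOn Set.univ α g) {s : ℝ} (hs0 : 0 < s) (hs1 : s < 1)
    (x₀ x₁ : EuclideanSpace ℝ (Fin d)) :
    (1 - s) * log (tiltedMass d η g 0 x₀) + s * log (tiltedMass d η g 0 x₁)
      + α / (1 + η * α) / 2 * (s * (1 - s)) * ‖x₁ - x₀‖ ^ 2
      ≤ log (tiltedMass d η g 0 ((1 - s) • x₀ + s • x₁)) := by
  have hgm := (hg.continuous_of_univ hα).measurable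
  set c := α / (1 + η * α) / 2 * (s * (1 - s)) * ‖x₁ - x₀‖ ^ 2 with hc
  have hZ := tiltedMass_pos hη hα hg (h := 0) measurable_zero (H := 0) (fun _ => le_rfl)
    ((1 - s) • x₀ + s • x₁)
  have hi := fun x => integrable_tiltedMass hη hα hg (h := 0) measurable_zero (H := 0)
    (fun _ => le_rfl) x
  have eM : ∀ y, rexp (((0 : EuclideanSpace ℝ (Fin d) → ℝ) y - g y
      - ‖(1 - s) • x₀ + s • x₁ - y‖ ^ 2 / (2 * η)) - c) =
      rexp (-c) * rexp ((0 : EuclideanSpace ℝ (Fin d) → ℝ) y - g y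
      - ‖(1 - s) • x₀ + s • x₁ - y‖ ^ 2 / (2 * η)) := by
    intro y
    rw [← Real.exp_add]
    ring_nf
  have key := log_prekopa_leindler hs0 hs1
    (A := fun y => (0 : EuclideanSpace ℝ (Fin d) → ℝ) y - g y - ‖x₀ - y‖ ^ 2 / (2 * η))
    (B := fun y => (0 : EuclideanSpace ℝ (Fin d) → ℝ) y - g y - ‖x₁ - y‖ ^ 2 / (2 * η))
    (M := fun y => ((0 : EuclideanSpace ℝ (Fin d) → ℝ) y - g y
      - ‖(1 - s) • x₀ + s • x₁ - y‖ ^ 2 / (2 * η)) - c)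
    (by fun_prop) (by fun_prop) (by fun_prop) (hi x₀) (hi x₁)
    (by simp only [eM]; exact (hi _).const_mul _) ?_
  · simp only [eM] at key
    rw [integral_const_mul] at key
    change (1 - s) * log (tiltedMass d η g 0 x₀) + s * log (tiltedMass d η g 0 x₁) ≤
      log (rexp (-c) * tiltedMass d η g 0 ((1 - s) • x₀ + s • x₁)) at key
    rw [Real.log_mul (Real.exp_ne_zero _) hZ.ne', Real.log_exp] at key
    linarith
  · intro y₀ y₁
    have h1 := hg.2 (Set.mem_univ y₀) (Set.mem_univ y₁) (show 0 ≤ 1 - s by linarith) hs0.le (by ring)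
    have h2 := norm_sq_convex_comb s (x₀ - y₀) (x₁ - y₁)
    have h3 : (1 - s) • x₀ + s • x₁ - ((1 - s) • y₀ + s • y₁) =
        (1 - s) • (x₀ - y₀) + s • (x₁ - y₁) := by
      simp only [smul_sub]; abel
    have h4 := norm_add_sq_le_of_pos hη hα (y₀ - y₁) (x₀ - y₀ - (x₁ - y₁))
    have h5 : y₀ - y₁ + (x₀ - y₀ - (x₁ - y₁)) = x₀ - x₁ := by abel
    rw [h5, norm_sub_rev x₀] at h4
    simp only [smul_eq_mul, Pi.zero_apply, zero_sub] at h1 ⊢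
    rw [h3, h2, hc]
    have h6 := mul_le_mul_of_nonneg_left h4 (show 0 ≤ s * (1 - s) / 2 by
      have : 0 ≤ 1 - s := by linarith
      positivity)
    have e1 : ((1 - s) * ‖x₀ - y₀‖ ^ 2 + s * ‖x₁ - y₁‖ ^ 2
        - s * (1 - s) * ‖x₀ - y₀ - (x₁ - y₁)‖ ^ 2) / (2 * η) =
        (1 - s) * (‖x₀ - y₀‖ ^ 2 / (2 * η)) + s * (‖x₁ - y₁‖ ^ 2 / (2 * η))
        - s * (1 - s) / 2 * (‖x₀ - y₀ - (x₁ - y₁)‖ ^ 2 / η) := by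
      field_simp
    rw [e1]
    linarith

/-- The quadratic upper bound for the log partition function, with the drift as gradient. -/
theorem log_tiltedMass_le (hη : 0 < η) (hα : 0 < α) (hg : StrongConvexOn Set.univ α g)
    (x a : EuclideanSpace ℝ (Fin d)) :
    log (tiltedMass d η g 0 (x + a)) ≤ log (tiltedMass d η g 0 x) - drift d η g x a / η
      - α / (1 + η * α) / 2 * ‖a‖ ^ 2 := by
  refine le_of_forall_pos_le_add fun ε hε => ?_
  set Q := ‖a‖ ^ 2 / (2 * η) with hQ
  have hQ0 : 0 ≤ Q := by positivity
  set s := ε / (Q + 1) with hs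
  have hs0 : 0 < s := by positivity
  have hsQ : s * Q ≤ ε := by
    rw [hs, div_mul_eq_mul_div, div_le_iff₀ (by positivity)]
    nlinarith
  have h1 := log_tiltedMass_add_ge hη hα hg (h := 0) measurable_zero (H := 0) (by simp) x (-s • a)
  have h2 := log_tiltedMass_strongly_concave hη hα hg (s := s / (1 + s)) (by positivity)
    ((div_lt_one (by positivity)).2 (by linarith)) (x + -s • a) (x + a)
  have e1 : (1 - s / (1 + s)) • (x + -s • a) + (s / (1 + s)) • (x + a) = x := by
    have : 1 - s / (1 + s) = 1 / (1 + s) := by field_simp; ring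
    rw [this]
    have e : (1 / (1 + s)) • (x + -s • a) + (s / (1 + s)) • (x + a) =
        (1 / (1 + s) + s / (1 + s)) • x + (s / (1 + s) - 1 / (1 + s) * s) • a := by
      module
    rw [e]
    have e2 : 1 / (1 + s) + s / (1 + s) = 1 := by field_simp
    have e3 : s / (1 + s) - 1 / (1 + s) * s = 0 := by field_simp; ring
    rw [e2, e3]; simp
  have e2 : x + a - (x + -s • a) = (1 + s) • a := by module
  rw [e1, e2, norm_smul, mul_pow, Real.norm_eq_abs, sq_abs] at h2
  rw [drift_smul, norm_smul, mul_pow, Real.norm_eq_abs, sq_abs] at h1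
  simp only [Pi.zero_apply, integral_zero, add_zero] at h1
  have h3 := mul_le_mul_of_nonneg_left h2 (show 0 ≤ 1 + s by positivity)
  set L := log (tiltedMass d η g 0 x)
  set Lpos := log (tiltedMass d η g 0 (x + a))
  set Lneg := log (tiltedMass d η g 0 (x + -s • a))
  set D := drift d η g x a
  set κ := α / (1 + η * α)
  have e4 : (1 + s) * ((1 - s / (1 + s)) * Lneg + s / (1 + s) * Lpos +
      κ / 2 * (s / (1 + s) * (1 - s / (1 + s))) * ((1 + s) ^ 2 * ‖a‖ ^ 2)) =
      Lneg + s * Lpos + s * ((1 + s) * (κ / 2 * ‖a‖ ^ 2)) := by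
    field_simp
    ring
  have e5 : (2 * (-s * D) + (-s) ^ 2 * ‖a‖ ^ 2) / (2 * η) = s * (-(D / η) + s * Q) := by
    rw [hQ]; field_simp
  rw [e4] at h3
  rw [e5] at h1
  have hκ : 0 ≤ s * (κ / 2 * ‖a‖ ^ 2) := by positivity
  have h4 : s * (Lpos + (1 + s) * (κ / 2 * ‖a‖ ^ 2)) ≤ s * (L - D / η + s * Q) := by linarith
  have h5 := le_of_mul_le_mul_left h4 hs0
  linarith

/-- The **Donsker–Varadhan inequality** for bounded functions. -/
theorem integral_le_klDiv_add_log_integral_exp {X : Type*} [MeasurableSpace X] {ν ρ : Measure X}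
    [IsProbabilityMeasure ν] [IsProbabilityMeasure ρ] (hfin : InformationTheory.klDiv ν ρ ≠ ⊤)
    {F : X → ℝ} (hF : Measurable F) {B : ℝ} (hB : ∀ x, |F x| ≤ B) :
    ∫ x, F x ∂ν ≤ (InformationTheory.klDiv ν ρ).toReal + log (∫ x, rexp (F x) ∂ρ) := by
  obtain ⟨hac, hint⟩ := InformationTheory.klDiv_ne_top_iff.1 hfin
  have hFν : Integrable F ν :=
    (integrable_const B).mono' hF.aestronglyMeasurable (ae_of_all _ hB)
  have hFρ : Integrable (fun x => rexp (F x)) ρ :=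
    (integrable_const (rexp B)).mono' hF.exp.aestronglyMeasurable (ae_of_all _ fun x => by
      rw [Real.norm_of_nonneg (Real.exp_nonneg _), Real.exp_le_exp]
      exact (le_abs_self _).trans (hB x))
  have := isProbabilityMeasure_tilted hFρ
  have hac' : ν ≪ ρ.tilted F := hac.trans (absolutelyContinuous_tilted hFρ)
  have h1 := InformationTheory.integral_llr_add_sub_measure_univ_nonneg hac'
    (integrable_llr_tilted_right hac hFν hint hFρ)
  rw [integral_llr_tilted_right hac hFν hFρ hint] at h1
  rw [InformationTheory.toReal_klDiv_of_measure_eq hac (by simp)]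
  simp only [probReal_univ] at h1
  linarith

theorem abs_log_max_min_le {r a b : ℝ} (hr : 0 < r) (ha : a ≤ 1) (hb : 1 ≤ b) :
    |log (max a (min r b))| ≤ |log r| := by
  rcases le_total r 1 with h | h
  · have h1 : r ≤ max a (min r b) := le_max_of_le_right (le_min le_rfl (h.trans hb))
    have h2 : max a (min r b) ≤ 1 := max_le ha ((min_le_left _ _).trans h)
    rw [abs_of_nonpos (Real.log_nonpos (hr.le.trans h1) h2), abs_of_nonpos (Real.log_nonpos hr.le h)]
    exact neg_le_neg (Real.log_le_log hr h1)
  · have h1 : max a (min r b) ≤ r := max_le (ha.trans h) (min_le_left _ _)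
    have h2 : 1 ≤ max a (min r b) := le_max_of_le_right (le_min h hb)
    rw [abs_of_nonneg (Real.log_nonneg h2), abs_of_nonneg (Real.log_nonneg h)]
    exact Real.log_le_log (by linarith) h1

theorem integral_bind_kernel {X Y : Type*} [MeasurableSpace X] [MeasurableSpace Y]
    (κ : ProbabilityTheory.Kernel X Y) [ProbabilityTheory.IsMarkovKernel κ] {ν : Measure X}
    [SFinite ν] {F : Y → ℝ} (hF : Integrable F (ν.bind κ)) :
    ∫ y, F y ∂(ν.bind κ) = ∫ x, ∫ y, F y ∂(κ x) ∂ν := by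
  rw [← Measure.snd_compProd] at hF ⊢
  rw [Measure.snd] at hF ⊢
  rw [integral_map measurable_snd.aemeasurable hF.aestronglyMeasurable]
  exact Measure.integral_compProd (hF.comp_measurable measurable_snd)

/-- A functional inequality for a Markov kernel implies contraction of the relative entropy. -/
theorem klDiv_comp_le_of_log_integral_exp_le {X Y : Type*} [MeasurableSpace X] [MeasurableSpace Y]
    (κ : ProbabilityTheory.Kernel X Y) [ProbabilityTheory.IsMarkovKernel κ] {ν ρ : Measure X}
    [IsProbabilityMeasure ν] [IsProbabilityMeasure ρ] {C : ℝ} (hC : 0 < C)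
    (hfun : ∀ h : Y → ℝ, Measurable h → ∀ H : ℝ, (∀ y, |h y| ≤ H) →
      C⁻¹ * log (∫ x, rexp (C * ∫ y, h y ∂(κ x)) ∂ρ) ≤ log (∫ y, rexp (h y) ∂(ρ.bind κ))) :
    InformationTheory.klDiv (ν.bind κ) (ρ.bind κ) ≤
      ENNReal.ofReal C⁻¹ * InformationTheory.klDiv ν ρ := by
  by_cases hfin : InformationTheory.klDiv ν ρ = ⊤
  · rw [hfin, ENNReal.mul_top (by simpa using hC)]
    exact le_top
  have hfin' : InformationTheory.klDiv (ν.bind κ) (ρ.bind κ) ≠ ⊤ :=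
    ne_top_of_le_ne_top hfin (InformationTheory.klDiv_comp_right_le ν ρ κ)
  obtain ⟨hac, hint⟩ := InformationTheory.klDiv_ne_top_iff.1 hfin'
  have := (inferInstance : IsProbabilityMeasure (ν.bind κ))
  have := (inferInstance : IsProbabilityMeasure (ρ.bind κ))
  set r : Y → ℝ := fun y => ((ν.bind κ).rnDeriv (ρ.bind κ) y).toReal with hr
  have hrm : Measurable r := (Measure.measurable_rnDeriv _ _).ennreal_toReal
  have hr0 : ∀ y, 0 ≤ r y := fun y => ENNReal.toReal_nonneg
  have hri : Integrable r (ρ.bind κ) := Measure.integrable_toReal_rnDeriv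
  have hr1 : ∫ y, r y ∂(ρ.bind κ) = 1 := by
    rw [Measure.integral_toReal_rnDeriv hac]; simp
  set K := (InformationTheory.klDiv ν ρ).toReal with hK
  let cl : ℕ → Y → ℝ := fun n y => max (1 / ((n : ℝ) + 1)) (min (r y) ((n : ℝ) + 1))
  have hclm : ∀ n, Measurable (cl n) := fun n => by fun_prop
  have hn : ∀ n : ℕ, 1 / ((n : ℝ) + 1) ≤ 1 := fun n => by
    rw [div_le_one (by positivity)]; linarith [(Nat.cast_nonneg n : (0 : ℝ) ≤ n)]
  have hn' : ∀ n : ℕ, (1 : ℝ) ≤ (n : ℝ) + 1 := fun n => by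
    linarith [(Nat.cast_nonneg n : (0 : ℝ) ≤ n)]
  have hclpos : ∀ (n : ℕ) y, 1 / ((n : ℝ) + 1) ≤ cl n y := fun n y => le_max_left _ _
  have hclpos' : ∀ (n : ℕ) y, 0 < cl n y := fun n y => 
    lt_of_lt_of_le (by positivity) (hclpos n y)
  have hclle : ∀ (n : ℕ) y, cl n y ≤ (n : ℝ) + 1 := fun n y =>
    max_le ((hn n).trans (hn' n)) (min_le_right _ _)
  have hbd : ∀ (n : ℕ) y, |log (cl n y)| ≤ log ((n : ℝ) + 1) := fun n y => by
    rw [abs_le]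
    refine ⟨?_, Real.log_le_log (hclpos' n y) (hclle n y)⟩
    have := Real.log_le_log (by positivity) (hclpos n y)
    rwa [one_div, Real.log_inv] at this
  have hstep : ∀ n : ℕ, ∫ y, log (cl n y) ∂(ν.bind κ) ≤ C⁻¹ * K + 1 / ((n : ℝ) + 1) := by
    intro n
    have hm := (hclm n).log
    have hκm : Measurable fun x => ∫ y, log (cl n y) ∂(κ x) :=
      hm.stronglyMeasurable.integral_kernel.measurable
    have hκb : ∀ x, |C * ∫ y, log (cl n y) ∂(κ x)| ≤ C * log ((n : ℝ) + 1) := fun x => by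
      rw [abs_mul, abs_of_pos hC]
      refine mul_le_mul_of_nonneg_left ?_ hC.le
      simpa using norm_integral_le_of_norm_le_const (μ := κ x) (f := fun y => log (cl n y))
        (ae_of_all _ (hbd n))
    have hlog : Integrable (fun y => log (cl n y)) (ν.bind κ) :=
      (integrable_const (log ((n : ℝ) + 1))).mono' hm.aestronglyMeasurable (ae_of_all _ (hbd n))
    have h1 := integral_le_klDiv_add_log_integral_exp hfin (hκm.const_mul C) hκb
    have h2 := hfun _ hm _ (hbd n)
    rw [integral_const_mul] at h1
    have h3 : ∫ y, rexp (log (cl n y)) ∂(ρ.bind κ) ≤ 1 / ((n : ℝ) + 1) + 1 := by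
      simp only [Real.exp_log (hclpos' n _)]
      calc ∫ y, cl n y ∂(ρ.bind κ) ≤ ∫ y, (1 / ((n : ℝ) + 1) + r y) ∂(ρ.bind κ) := by
            refine integral_mono ?_ ((integrable_const _).add hri) fun y => ?_
            · refine (integrable_const ((n : ℝ) + 1)).mono' (hclm n).aestronglyMeasurable
                (ae_of_all _ fun y => ?_)
              rw [Real.norm_of_nonneg (hclpos' n y).le]
              exact hclle n y
            · have : 0 < 1 / ((n : ℝ) + 1) := by positivity
              exact max_le (by linarith [hr0 y]) ((min_le_left _ _).trans (by linarith))
        _ = 1 / ((n : ℝ) + 1) + 1 := by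
            rw [integral_add (integrable_const _) hri, hr1]; simp
    have h4 : log (∫ y, rexp (log (cl n y)) ∂(ρ.bind κ)) ≤ 1 / ((n : ℝ) + 1) := by
      have hpos : 0 < ∫ y, rexp (log (cl n y)) ∂(ρ.bind κ) := by
        refine integral_exp_pos ?_
        simp only [Real.exp_log (hclpos' n _)]
        refine (integrable_const ((n : ℝ) + 1)).mono' (hclm n).aestronglyMeasurable
                (ae_of_all _ fun y => ?_)
        rw [Real.norm_of_nonneg (hclpos' n y).le]
        exact hclle n y
      linarith [Real.log_le_sub_one_of_pos hpos]
    rw [integral_bind_kernel κ hlog]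
    have h5 := mul_le_mul_of_nonneg_left h1 (inv_pos.2 hC).le
    rw [inv_mul_cancel_left₀ hC.ne', mul_add] at h5
    linarith
  have hlim : Filter.Tendsto (fun n => ∫ y, log (cl n y) ∂(ν.bind κ)) Filter.atTop
      (nhds (∫ y, llr (ν.bind κ) (ρ.bind κ) y ∂(ν.bind κ))) := by
    refine tendsto_integral_of_dominated_convergence
      (fun y => |llr (ν.bind κ) (ρ.bind κ) y|) (fun n => (hclm n).log.aestronglyMeasurable)
      hint.abs (fun n => ?_) ?_
    · filter_upwards [Measure.rnDeriv_pos hac,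
        hac.ae_le (Measure.rnDeriv_lt_top (ν.bind κ) (ρ.bind κ))] with y hy hy'
      exact abs_log_max_min_le (ENNReal.toReal_pos hy.ne' hy'.ne) (hn n) (hn' n)
    · filter_upwards [Measure.rnDeriv_pos hac,
        hac.ae_le (Measure.rnDeriv_lt_top (ν.bind κ) (ρ.bind κ))] with y hy0 hy'
      have hy : 0 < r y := ENNReal.toReal_pos hy0.ne' hy'.ne
      refine tendsto_const_nhds.congr' ?_
      have e1 : ∀ᶠ n : ℕ in Filter.atTop, 1 / ((n : ℝ) + 1) < r y :=
        tendsto_one_div_add_atTop_nhds_zero_nat.eventually_lt_const hy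
      filter_upwards [e1, tendsto_natCast_atTop_atTop.eventually_ge_atTop (r y)] with n h1 h2
      change log (r y) = log (max (1 / ((n : ℝ) + 1)) (min (r y) ((n : ℝ) + 1)))
      rw [min_eq_left (by linarith), max_eq_right h1.le]
  have hlim2 : Filter.Tendsto (fun n : ℕ => C⁻¹ * K + 1 / ((n : ℝ) + 1)) Filter.atTop
      (nhds (C⁻¹ * K + 0)) := tendsto_one_div_add_atTop_nhds_zero_nat.const_add _
  have hle := le_of_tendsto_of_tendsto' hlim hlim2 hstep
  rw [add_zero] at hle
  rw [← ENNReal.ofReal_toReal hfin, ← ENNReal.ofReal_mul (inv_pos.2 hC).le,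
    ← ENNReal.ofReal_toReal hfin', InformationTheory.toReal_klDiv_of_measure_eq hac (by simp)]
  exact ENNReal.ofReal_le_ofReal hle

theorem measurable_integral_gibbsKernel (hgm : Measurable g) {h : EuclideanSpace ℝ (Fin d) → ℝ}
    (hh : Measurable h) : Measurable fun x => ∫ y, h y ∂(gibbsKernel d η g x) := by
  simp only [integral_gibbsKernel hgm]
  have : StronglyMeasurable fun p : EuclideanSpace ℝ (Fin d) × EuclideanSpace ℝ (Fin d) =>
      condYgivenX d η g p.1 p.2 * h p.2 :=
    ((measurable_condYgivenX hgm).mul (hh.comp measurable_snd)).stronglyMeasurable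
  exact this.integral_prod_right.measurable

theorem tiltedMass_le (hη : 0 < η) (hα : 0 < α) (hg : StrongConvexOn Set.univ α g)
    {h : EuclideanSpace ℝ (Fin d) → ℝ} (hh : Measurable h) {H : ℝ} (hH : ∀ y, h y ≤ H)
    (x : EuclideanSpace ℝ (Fin d)) :
    tiltedMass d η g h x ≤ rexp H * ∫ y, rexp (-g y) := by
  rw [← integral_const_mul]
  refine integral_mono (integrable_tiltedMass hη hα hg hh hH x)
    ((hg.integrable_exp_neg hα).const_mul _) fun y => ?_
  simp only
  rw [← Real.exp_add, Real.exp_le_exp]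
  have : 0 ≤ ‖x - y‖ ^ 2 / (2 * η) := by positivity
  linarith [hH y]

/-- The weighted partition function is integrable against `exp (-f)`. -/
theorem integrable_exp_neg_mul_tiltedMass (hη : 0 < η) {αf αg : ℝ}
    {f g : EuclideanSpace ℝ (Fin d) → ℝ} (hαf : 0 < αf) (hαg : 0 < αg)
    (hf : StrongConvexOn Set.univ αf f) (hg : StrongConvexOn Set.univ αg g)
    {h : EuclideanSpace ℝ (Fin d) → ℝ} (hh : Measurable h) {H : ℝ} (hH : ∀ y, h y ≤ H) :
    Integrable fun x => rexp (-f x) * tiltedMass d η g h x := by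
  have hfm := (hf.continuous_of_univ hαf).measurable
  have hgm := (hg.continuous_of_univ hαg).measurable
  have hm := measurable_tiltedMass (η := η) hgm hh
  refine ((hf.integrable_exp_neg hαf).mul_const (rexp H * ∫ y, rexp (-g y))).mono'
    (by fun_prop) (ae_of_all _ fun x => ?_)
  rw [Real.norm_of_nonneg (mul_nonneg (Real.exp_nonneg _) (tiltedMass_pos hη hαg hg hh hH x).le)]
  exact mul_le_mul_of_nonneg_left (tiltedMass_le hη hαg hg hh hH x) (Real.exp_nonneg _)

/-- A reverse-hypercontractivity type inequality for the Gibbs kernel: the functional form of the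
contraction of relative entropy. -/
theorem log_integral_exp_gibbsKernel_le (hη : 0 < η) {αf αg : ℝ}
    {f g : EuclideanSpace ℝ (Fin d) → ℝ} (hαf : 0 < αf) (hαg : 0 < αg)
    (hf : StrongConvexOn Set.univ αf f) (hg : StrongConvexOn Set.univ αg g) {C : ℝ}
    (hC : C = (1 + η * αf) * (1 + η * αg))
    {h : EuclideanSpace ℝ (Fin d) → ℝ} (hh : Measurable h) {H : ℝ} (hH : ∀ y, |h y| ≤ H) :
    C⁻¹ * log (∫ x, rexp (C * ∫ y, h y ∂(gibbsKernel d η g x)) *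
        (rexp (-f x) * tiltedMass d η g 0 x))
      + (1 - C⁻¹) * log (∫ x, rexp (-f x) * tiltedMass d η g 0 x)
      ≤ log (∫ x, rexp (-f x) * tiltedMass d η g h x) := by
  have hfm := (hf.continuous_of_univ hαf).measurable
  have hgm := (hg.continuous_of_univ hαg).measurable
  have hK := isMarkovKernel_gibbsKernel hη hαg hg
  have hH' : ∀ y, h y ≤ H := fun y => (le_abs_self _).trans (hH y)
  have hmK := measurable_integral_gibbsKernel (η := η) hgm hh
  have hmZ := measurable_tiltedMass (η := η) hgm (h := 0) measurable_zero
  have hmW := measurable_tiltedMass (η := η) hgm hh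
  have hZ := tiltedMass_pos hη hαg hg (h := 0) measurable_zero (H := 0) (fun _ => le_rfl)
  have hW := tiltedMass_pos hη hαg hg hh hH'
  have iZ := integrable_exp_neg_mul_tiltedMass hη hαf hαg hf hg (h := 0) measurable_zero (H := 0)
    (fun _ => le_rfl)
  have iW := integrable_exp_neg_mul_tiltedMass hη hαf hαg hf hg hh hH'
  have hKH : ∀ x, |∫ y, h y ∂(gibbsKernel d η g x)| ≤ H := fun x => by
    simpa using norm_integral_le_of_norm_le_const (μ := gibbsKernel d η g x) (f := h)
      (ae_of_all _ hH)
  have hp1 : 0 < η * αf := by positivity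
  have hp2 : 0 < η * αg := by positivity
  have hC1 : 1 < C := by rw [hC]; nlinarith
  have hC0 : 0 < C := by linarith
  have hCi : C⁻¹ < 1 := inv_lt_one_of_one_lt₀ hC1
  have hCi0 : 0 < C⁻¹ := by positivity
  have eA : ∀ x, rexp (C * (∫ y, h y ∂(gibbsKernel d η g x)) - f x + log (tiltedMass d η g 0 x)) =
      rexp (C * ∫ y, h y ∂(gibbsKernel d η g x)) * (rexp (-f x) * tiltedMass d η g 0 x) := by
    intro x
    rw [Real.exp_add, Real.exp_log (hZ x), sub_eq_add_neg, Real.exp_add, mul_assoc]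
  have eB : ∀ x, rexp (-f x + log (tiltedMass d η g 0 x)) =
      rexp (-f x) * tiltedMass d η g 0 x := by
    intro x
    rw [Real.exp_add, Real.exp_log (hZ x)]
  have eM : ∀ x, rexp (-f x + log (tiltedMass d η g h x)) =
      rexp (-f x) * tiltedMass d η g h x := by
    intro x
    rw [Real.exp_add, Real.exp_log (hW x)]
  have key := log_prekopa_leindler (t := 1 - C⁻¹) (by linarith) (by linarith)
    (A := fun x => C * (∫ y, h y ∂(gibbsKernel d η g x)) - f x + log (tiltedMass d η g 0 x))
    (B := fun x => -f x + log (tiltedMass d η g 0 x))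
    (M := fun x => -f x + log (tiltedMass d η g h x))
    (by fun_prop) (by fun_prop) (by fun_prop) ?_ (by simpa only [eB] using iZ)
    (by simpa only [eM] using iW) ?_
  · simp only [eA, eB, eM, sub_sub_cancel] at key
    exact key
  · simp only [eA]
    refine iZ.bdd_mul (c := rexp (C * H)) (hmK.const_mul C).exp.aestronglyMeasurable (ae_of_all _ fun x => ?_)
    rw [Real.norm_of_nonneg (Real.exp_nonneg _), Real.exp_le_exp]
    exact mul_le_mul_of_nonneg_left ((le_abs_self _).trans (hKH x)) hC0.le
  · intro x x'
    set t := 1 - C⁻¹ with ht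
    have ht' : 1 - t = C⁻¹ := by rw [ht]; ring
    obtain ⟨a, rfl⟩ : ∃ a, x' = x + a := ⟨x' - x, by abel⟩
    have hz : (1 - t) • x + t • (x + a) = x + t • a := by module
    have h1 := log_tiltedMass_add_ge hη hαg hg hh hH x (t • a)
    have h2 := log_tiltedMass_le hη hαg hg x a
    have h3 := hf.2 (Set.mem_univ x) (Set.mem_univ (x + a)) (show 0 ≤ 1 - t by rw [ht']; positivity)
      (show 0 ≤ t by rw [ht]; linarith) (by ring)
    rw [hz] at h3 ⊢
    have e1 : x - (x + a) = -a := by abel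
    rw [e1, norm_neg] at h3
    rw [drift_smul, norm_smul, mul_pow, Real.norm_eq_abs, sq_abs] at h1
    simp only [smul_eq_mul] at h3
    have h4 := mul_le_mul_of_nonneg_left h2 (show 0 ≤ t by rw [ht]; linarith)
    have e2 : (1 - t) * (C * (∫ y, h y ∂(gibbsKernel d η g x)) - f x
        + log (tiltedMass d η g 0 x)) = (∫ y, h y ∂(gibbsKernel d η g x)) - (1 - t) * f x
        + (1 - t) * log (tiltedMass d η g 0 x) := by
      rw [ht', mul_add, mul_sub, inv_mul_cancel_left₀ hC0.ne']
    rw [e2]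
    have e3 : t / η = αg / (1 + η * αg) + (1 - t) * αf := by
      rw [ht', ht, hC]
      field_simp
      ring
    have e4 : (2 * (t * drift d η g x a) + t ^ 2 * ‖a‖ ^ 2) / (2 * η) =
        t * (drift d η g x a / η) + t / η * (t * ‖a‖ ^ 2 / 2) := by
      field_simp
    rw [e4, e3] at h1
    linarith

section Target

variable {αf αg : ℝ} {f : EuclideanSpace ℝ (Fin d) → ℝ}

theorem measurable_jointDens (hfm : Measurable f) (hgm : Measurable g) :
    Measurable (jointDens d η f g) := by
  unfold jointDens
  fun_prop

theorem integrable_jointDens (hη : 0 < η) (hαf : 0 < αf) (hαg : 0 < αg)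
    (hf : StrongConvexOn Set.univ αf f) (hg : StrongConvexOn Set.univ αg g) :
    Integrable (jointDens d η f g) := by
  have hfm := (hf.continuous_of_univ hαf).measurable
  have hgm := (hg.continuous_of_univ hαg).measurable
  refine ((hf.integrable_exp_neg hαf).mul_prod (hg.integrable_exp_neg hαg)).mono'
    (measurable_jointDens hfm hgm).aestronglyMeasurable (ae_of_all _ fun p => ?_)
  rw [jointDens, Real.norm_of_nonneg (Real.exp_nonneg _), ← Real.exp_add, Real.exp_le_exp]
  have : 0 ≤ ‖p.1 - p.2‖ ^ 2 / (2 * η) := by positivity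
  linarith

theorem integral_jointDens_pos (hη : 0 < η) (hαf : 0 < αf) (hαg : 0 < αg)
    (hf : StrongConvexOn Set.univ αf f) (hg : StrongConvexOn Set.univ αg g) :
    0 < ∫ q, jointDens d η f g q :=
  integral_exp_pos (integrable_jointDens hη hαf hαg hf hg)

theorem isProbabilityMeasure_targetXY (hη : 0 < η) (hαf : 0 < αf) (hαg : 0 < αg)
    (hf : StrongConvexOn Set.univ αf f) (hg : StrongConvexOn Set.univ αg g) :
    IsProbabilityMeasure (targetXY d η f g) := by
  have hN := integral_jointDens_pos hη hαf hαg hf hg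
  refine ⟨?_⟩
  rw [targetXY, withDensity_apply _ MeasurableSet.univ, Measure.restrict_univ,
    ← ofReal_integral_eq_lintegral_ofReal
      ((integrable_jointDens hη hαf hαg hf hg).div_const _)
      (ae_of_all _ fun p => div_nonneg (Real.exp_nonneg _) hN.le), integral_div, div_self hN.ne',
    ENNReal.ofReal_one]

theorem isProbabilityMeasure_targetX (hη : 0 < η) (hαf : 0 < αf) (hαg : 0 < αg)
    (hf : StrongConvexOn Set.univ αf f) (hg : StrongConvexOn Set.univ αg g) :
    IsProbabilityMeasure (targetX d η f g) := by
  have := isProbabilityMeasure_targetXY hη hαf hαg hf hg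
  exact Measure.isProbabilityMeasure_map measurable_fst.aemeasurable

theorem jointDens_eq (hη : 0 < η) (hαg : 0 < αg) (hg : StrongConvexOn Set.univ αg g)
    (x y : EuclideanSpace ℝ (Fin d)) :
    jointDens d η f g (x, y) =
      rexp (-f x) * tiltedMass d η g 0 x * condYgivenX d η g x y := by
  have hZ := tiltedMass_pos hη hαg hg (h := 0) measurable_zero (H := 0) (fun _ => le_rfl) x
  rw [condYgivenX_eq, mul_assoc, mul_div_cancel₀ _ hZ.ne', ← Real.exp_add, jointDens]
  ring_nf

theorem targetXY_eq_withDensity_compProd (hη : 0 < η) (hαf : 0 < αf) (hαg : 0 < αg)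
    (hf : StrongConvexOn Set.univ αf f) (hg : StrongConvexOn Set.univ αg g) :
    targetXY d η f g = (volume.withDensity fun x => ENNReal.ofReal
      (rexp (-f x) * tiltedMass d η g 0 x / ∫ q, jointDens d η f g q)).compProd
        (gibbsKernel d η g) := by
  have hfm := (hf.continuous_of_univ hαf).measurable
  have hgm := (hg.continuous_of_univ hαg).measurable
  have hN := integral_jointDens_pos hη hαf hαg hf hg
  have hK := isMarkovKernel_gibbsKernel hη hαg hg
  have hZm := measurable_tiltedMass (η := η) hgm (h := 0) measurable_zero
  have hZ := tiltedMass_pos hη hαg hg (h := 0) measurable_zero (H := 0) (fun _ => le_rfl)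
  have hJ := measurable_jointDens (η := η) hfm hgm
  rw [targetXY]
  set N := ∫ q, jointDens d η f g q
  ext s hs
  rw [withDensity_apply _ hs, ← lintegral_indicator hs, Measure.volume_eq_prod,
    lintegral_prod _ ((hJ.div_const _).ennreal_ofReal.indicator hs).aemeasurable,
    Measure.compProd_apply hs, lintegral_withDensity_eq_lintegral_mul _ (by fun_prop)
      (ProbabilityTheory.Kernel.measurable_kernel_prodMk_left hs)]
  refine lintegral_congr fun x => ?_
  have hsx : MeasurableSet (Prod.mk x ⁻¹' s) := measurable_prodMk_left hs
  have hm : Measurable (condYgivenX d η g x) :=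
    (measurable_condYgivenX (η := η) hgm).comp measurable_prodMk_left
  rw [Pi.mul_apply, gibbsKernel_apply hgm, withDensity_apply _ hsx, ← lintegral_indicator hsx,
    ← lintegral_const_mul _ (hm.ennreal_ofReal.indicator hsx)]
  refine lintegral_congr fun y => ?_
  by_cases h : (x, y) ∈ s
  · rw [Set.indicator_of_mem h, Set.indicator_of_mem (show y ∈ Prod.mk x ⁻¹' s from h),
      ← ENNReal.ofReal_mul (div_nonneg (mul_nonneg (Real.exp_nonneg _) (hZ x).le) hN.le),
      jointDens_eq hη hαg hg, div_mul_eq_mul_div]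
  · rw [Set.indicator_of_notMem h, Set.indicator_of_notMem (show y ∉ Prod.mk x ⁻¹' s from h),
      mul_zero]

theorem targetX_eq_withDensity (hη : 0 < η) (hαf : 0 < αf) (hαg : 0 < αg)
    (hf : StrongConvexOn Set.univ αf f) (hg : StrongConvexOn Set.univ αg g) :
    targetX d η f g = volume.withDensity fun x => ENNReal.ofReal
      (rexp (-f x) * tiltedMass d η g 0 x / ∫ q, jointDens d η f g q) := by
  have hK := isMarkovKernel_gibbsKernel hη hαg hg
  rw [targetX, targetXY_eq_withDensity_compProd hη hαf hαg hf hg]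
  exact Measure.fst_compProd _ _

/-- Disintegration of the two-node target. -/
theorem targetXY_eq_compProd (hη : 0 < η) (hαf : 0 < αf) (hαg : 0 < αg)
    (hf : StrongConvexOn Set.univ αf f) (hg : StrongConvexOn Set.univ αg g) :
    targetXY d η f g = (targetX d η f g).compProd (gibbsKernel d η g) := by
  rw [targetX_eq_withDensity hη hαf hαg hf hg, ← targetXY_eq_withDensity_compProd hη hαf hαg hf hg]

theorem jointDens_swap (p : EuclideanSpace ℝ (Fin d) × EuclideanSpace ℝ (Fin d)) :
    jointDens d η f g p.swap = jointDens d η g f p := by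
  simp only [jointDens, Prod.fst_swap, Prod.snd_swap]
  rw [norm_sub_rev]
  ring_nf

theorem map_swap_targetXY (hfm : Measurable f) (hgm : Measurable g) :
    (targetXY d η f g).map Prod.swap = targetXY d η g f := by
  have hswap : MeasurePreserving (Prod.swap : EuclideanSpace ℝ (Fin d) × EuclideanSpace ℝ (Fin d) →
      EuclideanSpace ℝ (Fin d) × EuclideanSpace ℝ (Fin d)) volume volume :=
    Measure.measurePreserving_swap
  have hJ := measurable_jointDens (η := η) hgm hfm
  have hN : ∫ q, jointDens d η f g q = ∫ q, jointDens d η g f q := by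
    rw [← hswap.integral_comp MeasurableEquiv.prodComm.measurableEmbedding]
    simp only [jointDens_swap]
  ext s hs
  rw [Measure.map_apply measurable_swap hs, targetXY, targetXY, withDensity_apply _ hs,
    withDensity_apply _ (measurable_swap hs),
    ← hswap.setLIntegral_comp_preimage hs (hJ.div_const _).ennreal_ofReal, hN]
  simp only [jointDens_swap]

/-- The Gibbs kernel maps the first marginal of the target to the second one. -/
theorem targetX_bind_gibbsKernel (hη : 0 < η) (hαf : 0 < αf) (hαg : 0 < αg)
    (hf : StrongConvexOn Set.univ αf f) (hg : StrongConvexOn Set.univ αg g) :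
    (targetX d η f g).bind (gibbsKernel d η g) = targetX d η g f := by
  have hK := isMarkovKernel_gibbsKernel hη hαg hg
  have := isProbabilityMeasure_targetX hη hαf hαg hf hg
  rw [← Measure.snd_compProd, ← targetXY_eq_compProd hη hαf hαg hf hg, targetX,
    ← map_swap_targetXY (hf.continuous_of_univ hαf).measurable
      (hg.continuous_of_univ hαg).measurable,
    Measure.map_map measurable_fst measurable_swap]
  rfl

theorem integral_targetX (hη : 0 < η) (hαf : 0 < αf) (hαg : 0 < αg)
    (hf : StrongConvexOn Set.univ αf f) (hg : StrongConvexOn Set.univ αg g)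
    (φ : EuclideanSpace ℝ (Fin d) → ℝ) :
    ∫ x, φ x ∂(targetX d η f g) =
      (∫ x, φ x * (rexp (-f x) * tiltedMass d η g 0 x)) / ∫ q, jointDens d η f g q := by
  have hfm := (hf.continuous_of_univ hαf).measurable
  have hgm := (hg.continuous_of_univ hαg).measurable
  have hN := integral_jointDens_pos hη hαf hαg hf hg
  have hZm := measurable_tiltedMass (η := η) hgm (h := 0) measurable_zero
  have hZ := tiltedMass_pos hη hαg hg (h := 0) measurable_zero (H := 0) (fun _ => le_rfl)
  rw [targetX_eq_withDensity hη hαf hαg hf hg,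
    integral_withDensity_eq_integral_toReal_smul (by fun_prop) (by simp), ← integral_div]
  refine integral_congr_ae (ae_of_all _ fun x => ?_)
  simp only
  rw [ENNReal.toReal_ofReal (div_nonneg (mul_nonneg (Real.exp_nonneg _) (hZ x).le) hN.le),
    smul_eq_mul]
  ring

/-- One half step of the two-node Gibbs sampler contracts the relative entropy. -/
theorem klDiv_bind_gibbsKernel_le (hη : 0 < η) (hαf : 0 < αf) (hαg : 0 < αg)
    (hf : StrongConvexOn Set.univ αf f) (hg : StrongConvexOn Set.univ αg g)
    (ν : Measure (EuclideanSpace ℝ (Fin d))) [IsProbabilityMeasure ν] :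
    InformationTheory.klDiv (ν.bind (gibbsKernel d η g)) (targetX d η g f) ≤
      ENNReal.ofReal ((1 + η * αf) * (1 + η * αg))⁻¹ *
        InformationTheory.klDiv ν (targetX d η f g) := by
  have hgm := (hg.continuous_of_univ hαg).measurable
  have hK := isMarkovKernel_gibbsKernel hη hαg hg
  have hprob := isProbabilityMeasure_targetX hη hαf hαg hf hg
  have hprob' := isProbabilityMeasure_targetX hη hαg hαf hg hf
  have hN := integral_jointDens_pos hη hαf hαg hf hg
  have hbind := targetX_bind_gibbsKernel hη hαf hαg hf hg
  have hZ := tiltedMass_pos hη hαg hg (h := 0) measurable_zero (H := 0) (fun _ => le_rfl)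
  rw [← hbind]
  refine klDiv_comp_le_of_log_integral_exp_le _ (by positivity) fun h hh H hH => ?_
  set N := ∫ q, jointDens d η f g q with hNdef
  set C := (1 + η * αf) * (1 + η * αg) with hC
  have key := log_integral_exp_gibbsKernel_le hη hαf hαg hf hg hC hh hH
  have hone : ∫ x, rexp (-f x) * tiltedMass d η g 0 x = N := by
    have := integral_targetX hη hαf hαg hf hg (fun _ => 1)
    simp only [integral_const, probReal_univ, smul_eq_mul, one_mul] at this
    rwa [eq_div_iff hN.ne', one_mul, eq_comm] at this
  have hexpint : Integrable (fun y => rexp (h y)) ((targetX d η f g).bind (gibbsKernel d η g)) := by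
    rw [hbind]
    refine (integrable_const (rexp H)).mono' hh.exp.aestronglyMeasurable (ae_of_all _ fun y => ?_)
    rw [Real.norm_of_nonneg (Real.exp_nonneg _), Real.exp_le_exp]
    exact (le_abs_self _).trans (hH y)
  have hpos : 0 < ∫ y, rexp (h y) ∂((targetX d η f g).bind (gibbsKernel d η g)) := by
    have : NeZero ((targetX d η f g).bind (gibbsKernel d η g)) := by rw [hbind]; infer_instance
    exact integral_exp_pos hexpint
  have hright : ∫ x, rexp (-f x) * tiltedMass d η g h x =
      (∫ y, rexp (h y) ∂((targetX d η f g).bind (gibbsKernel d η g))) * N := by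
    rw [integral_bind_kernel _ hexpint, integral_targetX hη hαf hαg hf hg, div_mul_cancel₀ _ hN.ne']
    refine integral_congr_ae (ae_of_all _ fun x => ?_)
    simp only
    rw [integral_gibbsKernel hgm]
    have e : ∀ y, condYgivenX d η g x y * rexp (h y) =
        rexp (h y - g y - ‖x - y‖ ^ 2 / (2 * η)) / tiltedMass d η g 0 x := by
      intro y
      have := condYgivenX_mul_exp hη (g := g) h x 0 y
      simpa using this
    simp only [e]
    rw [integral_div]
    change _ = tiltedMass d η g h x / tiltedMass d η g 0 x * _
    have := (hZ x).ne'
    field_simp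
  have hleft := integral_targetX hη hαf hαg hf hg
    (fun x => rexp (C * ∫ y, h y ∂(gibbsKernel d η g x)))
  rw [eq_div_iff hN.ne'] at hleft
  have hKm := (measurable_integral_gibbsKernel (η := η) hgm hh).const_mul C
  have hposl : 0 < ∫ x, rexp (C * ∫ y, h y ∂(gibbsKernel d η g x)) ∂(targetX d η f g) := by
    refine integral_exp_pos ((integrable_const (rexp (|C| * H))).mono'
      hKm.exp.aestronglyMeasurable (ae_of_all _ fun x => ?_))
    rw [Real.norm_of_nonneg (Real.exp_nonneg _), Real.exp_le_exp]
    refine (le_abs_self _).trans ?_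
    rw [abs_mul]
    refine mul_le_mul_of_nonneg_left ?_ (abs_nonneg _)
    simpa using norm_integral_le_of_norm_le_const (μ := gibbsKernel d η g x) (f := h)
      (ae_of_all _ hH)
  rw [hone, hright, ← hleft, Real.log_mul hposl.ne' hN.ne', Real.log_mul hpos.ne' hN.ne'] at key
  linarith

end Target

theorem klDiv_eq_informationTheory_klDiv {X : Type*} [MeasurableSpace X] (μ ν : Measure X)
    [IsFiniteMeasure μ] [IsFiniteMeasure ν] : klDiv μ ν = InformationTheory.klDiv μ ν := by
  rw [klDiv, InformationTheory.klDiv_eq_lintegral_klFun]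
  simp only [InformationTheory.klFun_apply]
  congr 1
  refine lintegral_congr fun x => ?_
  ring_nf

/-- The law obtained by integrating the conditional density is the composition with the kernel. -/
theorem withDensity_integral_condYgivenX (hη : 0 < η) (hα : 0 < α)
    (hg : StrongConvexOn Set.univ α g) (μ : Measure (EuclideanSpace ℝ (Fin d)))
    [IsProbabilityMeasure μ] :
    (volume.withDensity fun y => ENNReal.ofReal (∫ x, condYgivenX d η g x y ∂μ)) =
      μ.bind (gibbsKernel d η g) := by
  have hgm := (hg.continuous_of_univ hα).measurable
  have hK := isMarkovKernel_gibbsKernel hη hα hg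
  have hm := measurable_condYgivenX (η := η) hgm
  have hswap : ∀ s, MeasurableSet s → μ.bind (gibbsKernel d η g) s =
      ∫⁻ y in s, ∫⁻ x, ENNReal.ofReal (condYgivenX d η g x y) ∂μ := by
    intro s hs
    rw [Measure.bind_apply hs (gibbsKernel d η g).aemeasurable]
    simp only [gibbsKernel_apply hgm, withDensity_apply _ hs]
    exact lintegral_lintegral_swap hm.ennreal_ofReal.aemeasurable
  have hae : ∀ᵐ y, ENNReal.ofReal (∫ x, condYgivenX d η g x y ∂μ) =
      ∫⁻ x, ENNReal.ofReal (condYgivenX d η g x y) ∂μ := by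
    have htot := hswap Set.univ MeasurableSet.univ
    rw [measure_univ, Measure.restrict_univ] at htot
    have hmeas : Measurable fun y => ∫⁻ x, ENNReal.ofReal (condYgivenX d η g x y) ∂μ :=
      hm.ennreal_ofReal.lintegral_prod_left'
    filter_upwards [ae_lt_top hmeas (by rw [← htot]; simp)] with y hy
    have hmy : Measurable fun x => condYgivenX d η g x y := hm.comp measurable_prodMk_right
    refine ofReal_integral_eq_lintegral_ofReal ?_ (ae_of_all _ fun x => condYgivenX_nonneg g x y)
    exact (lintegral_ofReal_ne_top_iff_integrable hmy.aestronglyMeasurable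
      (ae_of_all _ fun x => condYgivenX_nonneg g x y)).1 hy.ne
  ext s hs
  rw [withDensity_apply _ hs, hswap s hs]
  exact lintegral_congr_ae (ae_restrict_of_ae hae)

end Gibbs

/-- linear convergence of the two-node Gibbs sampler under strong
convexity: with `μ_k^Y(y) = ∫ π^{Y|X=x}(y) dμ_k^X(x)`,
`μ_{k+1}^X(x) = ∫ π^{X|Y=y}(x) dμ_k^Y(y)` and `μ_k^{XY}` the joint law with density
`(x,y) ↦ μ_k^X(x) π^{Y|X=x}(y)`, one has
`D_KL(μ_k^{XY} ‖ π^{XY}) ≤ D_KL(μ_0^X ‖ π^X)/((1+ηα_f)^{2k}(1+ηα_g)^{2k})`. -/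
theorem two_node_gibbs_linear_convergence
    (hd : 1 ≤ d) (hη : 0 < η)
    (f g : EuclideanSpace ℝ (Fin d) → ℝ) (αf αg : ℝ) (hαf : 0 < αf) (hαg : 0 < αg)
    (hf : StrongConvexOn Set.univ αf f) (hg : StrongConvexOn Set.univ αg g)
    (μX μY : ℕ → Measure (EuclideanSpace ℝ (Fin d)))
    [IsProbabilityMeasure (μX 0)]
    (hKLfin : klDiv (μX 0) (targetX d η f g) < ⊤)
    (hμY : ∀ k, μY k = volume.withDensity fun y =>
      ENNReal.ofReal (∫ x, condYgivenX d η g x y ∂(μX k)))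
    (hμX : ∀ k, μX (k + 1) = volume.withDensity fun x =>
      ENNReal.ofReal (∫ y, condXgivenY d η f y x ∂(μY k)))
    (μXY : ℕ → Measure (EuclideanSpace ℝ (Fin d) × EuclideanSpace ℝ (Fin d)))
    (hμXY : ∀ k, ∀ s t : Set (EuclideanSpace ℝ (Fin d)),
      MeasurableSet s → MeasurableSet t →
      μXY k (s ×ˢ t) =
        ∫⁻ x in s, (volume.withDensity fun y =>
          ENNReal.ofReal (condYgivenX d η g x y)) t ∂(μX k)) :
    ∀ k : ℕ,
      klDiv (μXY k) (targetXY d η f g) ≤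
        klDiv (μX 0) (targetX d η f g) /
          ENNReal.ofReal ((1 + η * αf) ^ (2 * k) * (1 + η * αg) ^ (2 * k)) := by
  have hKg := isMarkovKernel_gibbsKernel hη hαg hg
  have hKf := isMarkovKernel_gibbsKernel hη hαf hf
  have hPXY := isProbabilityMeasure_targetXY hη hαf hαg hf hg
  have hPX := isProbabilityMeasure_targetX hη hαf hαg hf hg
  set C := (1 + η * αf) * (1 + η * αg) with hC
  have hC0 : 0 < C := by positivity
  have hstep : ∀ k, IsProbabilityMeasure (μX k) ∧
      InformationTheory.klDiv (μX k) (targetX d η f g) ≤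
        ENNReal.ofReal (C⁻¹ ^ (2 * k)) *
          InformationTheory.klDiv (μX 0) (targetX d η f g) := by
    intro k
    induction k with
    | zero => exact ⟨inferInstance, by simp⟩
    | succ k ih =>
      obtain ⟨hk, hle⟩ := ih
      have hY : μY k = (μX k).bind (gibbsKernel d η g) := by
        rw [hμY, withDensity_integral_condYgivenX hη hαg hg]
      have hYprob : IsProbabilityMeasure (μY k) := by rw [hY]; infer_instance
      have hX : μX (k + 1) = (μY k).bind (gibbsKernel d η f) := by
        rw [hμX, condXgivenY_eq, withDensity_integral_condYgivenX hη hαf hf]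
      have h1 := klDiv_bind_gibbsKernel_le hη hαf hαg hf hg (μX k)
      have h2 := klDiv_bind_gibbsKernel_le hη hαg hαf hg hf (μY k)
      rw [← hY, ← hC] at h1
      rw [← hX, mul_comm (1 + η * αg), ← hC] at h2
      refine ⟨by rw [hX]; infer_instance, h2.trans ?_⟩
      refine (mul_le_mul_right (h1.trans (mul_le_mul_right hle _)) _).trans_eq ?_
      rw [← mul_assoc, ← mul_assoc, ← ENNReal.ofReal_mul (by positivity),
        ← ENNReal.ofReal_mul (by positivity)]
      ring_nf
  intro k
  obtain ⟨hk, hle⟩ := hstep k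
  have hjoint : μXY k = (μX k).compProd (gibbsKernel d η g) := by
    refine (Measure.ext_prod fun {s t} hs ht => ?_).symm
    rw [hμXY k s t hs ht, Measure.compProd_apply_prod hs ht]
    simp only [gibbsKernel_apply (hg.continuous_of_univ hαg).measurable]
  have hXYprob : IsProbabilityMeasure (μXY k) := by rw [hjoint]; infer_instance
  rw [klDiv_eq_informationTheory_klDiv, klDiv_eq_informationTheory_klDiv, hjoint,
    targetXY_eq_compProd hη hαf hαg hf hg, InformationTheory.klDiv_compProd_left, ← mul_pow, ← hC,
    ENNReal.div_eq_inv_mul, ← ENNReal.ofReal_inv_of_pos (by positivity), ← inv_pow]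
  exact hle

end
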